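/- Let F̄_1, …, F̄_N : ℝ^M → ℝ be differentiable, each β-smooth, let ϱ_c ≥ 0 with Σ_c ϱ_c = 1, and suppose F = Σ_c ϱ_c F̄_c is μ-strongly convex (0 < μ ≤ β) with ∇F(w*) = 0 at w* ∈ ℝ^M. Let 0 < η ≤ 2/(μ+β), let v_1, …, v_N ∈ ℝ^M, set v_c' = v_c − η∇F̄_c(v_c), v̄ = Σ_c ϱ_c v_c and v̄' = Σ_c ϱ_c v_c'. Then ‖v̄' − w*‖ ≤ (1 − ημ)‖v̄ − w*‖ + ηβ Σ_c ϱ_c ‖v_c − v̄‖. -/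

import Mathlib

open scoped RealInnerProductSpace

section SmoothConvex

variable {E : Type*} [NormedAddCommGroup E] [InnerProductSpace ℝ E] [CompleteSpace E]

/-- Descent lemma: a function with `β`-Lipschitz gradient lies below its quadratic model. -/
theorem le_quadratic_of_lipschitz_gradient {f : E → ℝ} {G : E → E} {β : ℝ}
    (hf : ∀ w, HasGradientAt f (G w) w) (hG : ∀ w₁ w₂, ‖G w₁ - G w₂‖ ≤ β * ‖w₁ - w₂‖)
    (x y : E) : f y ≤ f x + ⟪G x, y - x⟫ + β / 2 * ‖y - x‖ ^ 2 := by
  set d := y - x with hd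
  let φ : ℝ → ℝ := fun t => f (x + t • d) - t * ⟪G x, d⟫ - β / 2 * ‖d‖ ^ 2 * t ^ 2
  have hφ (t : ℝ) :
      HasDerivAt φ (⟪G (x + t • d), d⟫ - ⟪G x, d⟫ - β / 2 * ‖d‖ ^ 2 * (2 * t)) t := by
    have hline : HasDerivAt (fun s : ℝ => x + s • d) d t := by
      simpa using ((hasDerivAt_id t).smul_const d).const_add x
    have hcomp : HasDerivAt (fun s : ℝ => f (x + s • d)) ⟪G (x + t • d), d⟫ t := by
      simpa [Function.comp_def] using
        (hf (x + t • d)).hasFDerivAt.comp_hasDerivAt t hline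
    have hlin : HasDerivAt (fun s : ℝ => s * ⟪G x, d⟫) ⟪G x, d⟫ t := by
      simpa using (hasDerivAt_id t).mul_const ⟪G x, d⟫
    have hsq : HasDerivAt (fun s : ℝ => β / 2 * ‖d‖ ^ 2 * s ^ 2)
        (β / 2 * ‖d‖ ^ 2 * (2 * t)) t := by
      simpa using (hasDerivAt_pow 2 t).const_mul (β / 2 * ‖d‖ ^ 2)
    exact (hcomp.sub hlin).sub hsq
  have hanti : AntitoneOn φ (Set.Icc 0 1) := by
    refine antitoneOn_of_deriv_nonpos (convex_Icc 0 1)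
      (fun t _ => (hφ t).continuousAt.continuousWithinAt)
      (fun t _ => (hφ t).differentiableAt.differentiableWithinAt) fun t ht => ?_
    rw [interior_Icc] at ht
    rw [(hφ t).deriv, ← inner_sub_left]
    have h₁ := real_inner_le_norm (G (x + t • d) - G x) d
    have h₂ := hG (x + t • d) x
    rw [add_sub_cancel_left, norm_smul, Real.norm_of_nonneg ht.1.le] at h₂
    nlinarith [mul_le_mul_of_nonneg_right h₂ (norm_nonneg d)]
  have h := hanti (Set.left_mem_Icc.2 zero_le_one) (Set.right_mem_Icc.2 zero_le_one) zero_le_one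
  simp only [φ, hd, one_smul, zero_smul, add_zero, add_sub_cancel] at h
  linarith

/-- A one-sided cocoercivity estimate for a `μ`-strongly convex function with `β`-Lipschitz
gradient `G`, in terms of the gradient `G - μ • id` of its convex part. -/
theorem bregman_lower_bound {f : E → ℝ} {G : E → E} {μ β : ℝ}
    (hf : ∀ w, HasGradientAt f (G w) w) (hG : ∀ w₁ w₂, ‖G w₁ - G w₂‖ ≤ β * ‖w₁ - w₂‖)
    (hconv : ∀ w₁ w₂, f w₂ + ⟪G w₂, w₁ - w₂⟫ + μ / 2 * ‖w₁ - w₂‖ ^ 2 ≤ f w₁)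
    (x y : E) (t : ℝ) :
    (t - (β - μ) / 2 * t ^ 2) * ‖G y - G x - μ • (y - x)‖ ^ 2
      ≤ f y - f x - ⟪G x, y - x⟫ - μ / 2 * ‖y - x‖ ^ 2 := by
  set d := y - x with hd
  set h := G y - G x - μ • d with hh
  have hup := le_quadratic_of_lipschitz_gradient hf hG y (y - t • h)
  have hlow := hconv (y - t • h) x
  have hx : y - t • h - x = d - t • h := by rw [hd]; abel
  have hy : y - t • h - y = -(t • h) := by abel
  have hGy : G y = h + G x + μ • d := by rw [hh]; abel
  rw [hx, norm_sub_sq_real, inner_sub_right, inner_smul_right, inner_smul_right, norm_smul,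
    mul_pow, Real.norm_eq_abs, sq_abs] at hlow
  rw [hy, norm_neg, inner_neg_right, inner_smul_right, norm_smul, mul_pow, Real.norm_eq_abs,
    sq_abs, hGy, inner_add_left, inner_add_left, inner_smul_left,
    real_inner_self_eq_norm_sq] at hup
  simp only [conj_trivial] at hup
  linarith

/-- Cocoercivity of the gradient of the convex part of a strongly convex smooth function. -/
theorem cocoercive_of_strong_convex {f : E → ℝ} {G : E → E} {μ β : ℝ} (hμβ : μ ≤ β)
    (hf : ∀ w, HasGradientAt f (G w) w) (hG : ∀ w₁ w₂, ‖G w₁ - G w₂‖ ≤ β * ‖w₁ - w₂‖)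
    (hconv : ∀ w₁ w₂, f w₂ + ⟪G w₂, w₁ - w₂⟫ + μ / 2 * ‖w₁ - w₂‖ ^ 2 ≤ f w₁) (x y : E) :
    ‖G y - G x - μ • (y - x)‖ ^ 2 ≤ (β - μ) * ⟪G y - G x - μ • (y - x), y - x⟫ := by
  have key (t : ℝ) : (2 * t - (β - μ) * t ^ 2) * ‖G y - G x - μ • (y - x)‖ ^ 2
      ≤ ⟪G y - G x - μ • (y - x), y - x⟫ := by
    have h₁ := bregman_lower_bound hf hG hconv x y t
    have h₂ := bregman_lower_bound hf hG hconv y x t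
    have hneg : G x - G y - μ • (x - y) = -(G y - G x - μ • (y - x)) := by module
    have hinner : ⟪G y, x - y⟫ = -⟪G y, y - x⟫ := by rw [← inner_neg_right, neg_sub]
    rw [hneg, norm_neg, hinner, norm_sub_rev x y] at h₂
    rw [inner_sub_left, inner_sub_left, inner_smul_left, real_inner_self_eq_norm_sq]
    simp only [conj_trivial]
    linarith
  generalize ⟪G y - G x - μ • (y - x), y - x⟫ = p at *
  generalize ‖G y - G x - μ • (y - x)‖ ^ 2 = q at *
  rcases hμβ.eq_or_lt with rfl | hlt
  · by_contra! hq
    rw [sub_self, zero_mul] at hq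
    have h := key ((p + 1) / (2 * q))
    have hcancel : 2 * ((p + 1) / (2 * q)) * q = p + 1 := by field_simp
    simp only [sub_self, zero_mul, sub_zero, hcancel] at h
    linarith
  · have hL : 0 < β - μ := sub_pos.2 hlt
    have h := mul_le_mul_of_nonneg_left (key (β - μ)⁻¹) hL.le
    have hcancel : (β - μ) * ((2 * (β - μ)⁻¹ - (β - μ) * (β - μ)⁻¹ ^ 2) * q) = q := by
      field_simp
      ring
    linarith

/-- A gradient step of size `η ≤ 2 / (μ + β)` contracts distances to a critical point. -/
theorem gradient_step_contraction {f : E → ℝ} {G : E → E} {μ β η : ℝ}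
    (hμ : 0 < μ) (hμβ : μ ≤ β)
    (hf : ∀ w, HasGradientAt f (G w) w) (hG : ∀ w₁ w₂, ‖G w₁ - G w₂‖ ≤ β * ‖w₁ - w₂‖)
    (hconv : ∀ w₁ w₂, f w₂ + ⟪G w₂, w₁ - w₂⟫ + μ / 2 * ‖w₁ - w₂‖ ^ 2 ≤ f w₁)
    (hη0 : 0 < η) (hη : η ≤ 2 / (μ + β)) {z : E} (hz : G z = 0) (x : E) :
    ‖x - η • G x - z‖ ≤ (1 - η * μ) * ‖x - z‖ := by
  have hηsum : η * (μ + β) ≤ 2 := (le_div_iff₀ (by linarith)).1 hη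
  have hημ : 0 ≤ 1 - η * μ := by nlinarith
  have hco := cocoercive_of_strong_convex hμβ hf hG hconv z x
  have hmono : 0 ≤ ⟪G x - G z - μ • (x - z), x - z⟫ := by
    have h₁ := hconv x z
    have h₂ := hconv z x
    have hinner : ⟪G x, z - x⟫ = -⟪G x, x - z⟫ := by rw [← inner_neg_right, neg_sub]
    rw [hinner, norm_sub_rev z x] at h₂
    rw [inner_sub_left, inner_sub_left, inner_smul_left, real_inner_self_eq_norm_sq]
    simp only [conj_trivial]
    linarith
  rw [hz, sub_zero] at hco hmono
  have hstep : x - η • G x - z = (1 - η * μ) • (x - z) - η • (G x - μ • (x - z)) := by module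
  rw [hstep]
  generalize G x - μ • (x - z) = h at *
  refine le_of_sq_le_sq ?_ (by positivity)
  rw [norm_sub_sq_real, inner_smul_left, inner_smul_right, norm_smul, norm_smul,
    Real.norm_of_nonneg hημ, Real.norm_of_nonneg hη0.le, real_inner_comm]
  simp only [conj_trivial]
  have h₁ := mul_le_mul_of_nonneg_left hco hη0.le
  have h₂ : η * (β - μ) * ⟪h, x - z⟫ ≤ 2 * (1 - η * μ) * ⟪h, x - z⟫ :=
    mul_le_mul_of_nonneg_right (by linarith) hmono
  have h₃ : η * (η * ‖h‖ ^ 2) ≤ η * (2 * (1 - η * μ) * ⟪h, x - z⟫) :=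
    mul_le_mul_of_nonneg_left (by linarith) hη0.le
  linarith

end SmoothConvex

/-- One-step bound on the optimality gap of the global noise-free variable:
if each subnet loss `F̄_c` is `β`-smooth, the weighted average `F = Σ_c ϱ_c F̄_c` is
`μ`-strongly convex with `∇F(w*) = 0` (where `∇F = Σ_c ϱ_c ∇F̄_c`), and `0 < η ≤ 2/(μ+β)`,
then with `v_c' = v_c - η ∇F̄_c(v_c)`, `v̄ = Σ_c ϱ_c v_c`, `v̄' = Σ_c ϱ_c v_c'`, we have
`‖v̄' - w*‖ ≤ (1 - ημ)‖v̄ - w*‖ + ηβ Σ_c ϱ_c ‖v_c - v̄‖`. -/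
theorem optimality_gap_one_step
    (M N : ℕ) (Fb : Fin N → EuclideanSpace ℝ (Fin M) → ℝ)
    (g : Fin N → EuclideanSpace ℝ (Fin M) → EuclideanSpace ℝ (Fin M))
    (ϱ : Fin N → ℝ) (μ β η : ℝ)
    (wstar : EuclideanSpace ℝ (Fin M))
    (hϱ0 : ∀ c, 0 ≤ ϱ c) (hϱ1 : ∑ c, ϱ c = 1)
    (hμ : 0 < μ) (hμβ : μ ≤ β)
    (hdiff : ∀ c w, HasGradientAt (Fb c) (g c w) w)
    (hsmooth : ∀ c, ∀ w₁ w₂ : EuclideanSpace ℝ (Fin M),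
      ‖g c w₁ - g c w₂‖ ≤ β * ‖w₁ - w₂‖)
    (hstrong : ∀ w₁ w₂ : EuclideanSpace ℝ (Fin M),
      (∑ c, ϱ c * Fb c w₂) + ⟪∑ c, ϱ c • g c w₂, w₁ - w₂⟫ + μ / 2 * ‖w₁ - w₂‖ ^ 2
        ≤ ∑ c, ϱ c * Fb c w₁)
    (hopt : (∑ c, ϱ c • g c wstar) = 0)
    (hη0 : 0 < η) (hη : η ≤ 2 / (μ + β))
    (v : Fin N → EuclideanSpace ℝ (Fin M)) :
    ‖(∑ c, ϱ c • (v c - η • g c (v c))) - wstar‖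
      ≤ (1 - η * μ) * ‖(∑ c, ϱ c • v c) - wstar‖
        + η * β * ∑ c, ϱ c * ‖v c - ∑ d, ϱ d • v d‖ := by
  have hgrad (w : EuclideanSpace ℝ (Fin M)) :
      HasGradientAt (fun w => ∑ c, ϱ c * Fb c w) (∑ c, ϱ c • g c w) w := by
    rw [hasGradientAt_iff_hasFDerivAt, map_sum]
    refine HasFDerivAt.fun_sum fun c _ => ?_
    simpa using (hdiff c w).hasFDerivAt.const_mul (ϱ c)
  have hnorm_sum (a : Fin N → EuclideanSpace ℝ (Fin M)) :
      ‖∑ c, ϱ c • a c‖ ≤ ∑ c, ϱ c * ‖a c‖ := by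
    refine norm_sum_le_of_le _ fun c _ => ?_
    rw [norm_smul, Real.norm_of_nonneg (hϱ0 c)]
  have hlip (w₁ w₂ : EuclideanSpace ℝ (Fin M)) :
      ‖(∑ c, ϱ c • g c w₁) - ∑ c, ϱ c • g c w₂‖ ≤ β * ‖w₁ - w₂‖ := by
    simp only [← Finset.sum_sub_distrib, ← smul_sub]
    calc _ ≤ ∑ c, ϱ c * ‖g c w₁ - g c w₂‖ := hnorm_sum _
      _ ≤ ∑ c, ϱ c * (β * ‖w₁ - w₂‖) :=
        Finset.sum_le_sum fun c _ => mul_le_mul_of_nonneg_left (hsmooth c w₁ w₂) (hϱ0 c)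
      _ = β * ‖w₁ - w₂‖ := by rw [← Finset.sum_mul, hϱ1, one_mul]
  set vbar := ∑ d, ϱ d • v d with hvbar
  have hcontr := gradient_step_contraction hμ hμβ hgrad hlip hstrong hη0 hη hopt vbar
  have hsplit : (∑ c, ϱ c • (v c - η • g c (v c))) - wstar
      = (vbar - η • (∑ c, ϱ c • g c vbar) - wstar)
        + η • ∑ c, ϱ c • (g c vbar - g c (v c)) := by
    simp only [smul_sub, Finset.sum_sub_distrib, Finset.smul_sum, smul_comm _ η]
    rw [← hvbar]
    abel
  have hdrift : ‖η • ∑ c, ϱ c • (g c vbar - g c (v c))‖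
      ≤ η * β * ∑ c, ϱ c * ‖v c - vbar‖ := by
    rw [norm_smul, Real.norm_of_nonneg hη0.le, mul_assoc]
    refine mul_le_mul_of_nonneg_left ((hnorm_sum _).trans ?_) hη0.le
    rw [Finset.mul_sum]
    refine Finset.sum_le_sum fun c _ => ?_
    have h := mul_le_mul_of_nonneg_left (hsmooth c vbar (v c)) (hϱ0 c)
    rw [norm_sub_rev vbar] at h
    linarith
  rw [hsplit]
  exact (norm_add_le _ _).trans (add_le_add hcontr hdrift)
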